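/- Assume that neither ψ(1̄)/φ(1̄) < min{ψ(d̄)/φ(d̄), 1} nor ψ(d̄)/φ(d̄) < min{ψ(1̄)/φ(1̄), 1} holds. Then for every x ∈ Σ that is not eventually constant and satisfies lim_{n→∞} S_nχ(x) = −∞, the generalised derivative of Θ exists at ξ := π_S(x); in fact lim_{η→ξ} D_Θ(ξ,η) ∈ [0,∞] exists (and under these assumptions equals 0 or a finite value), so no such ξ is a point of non-differentiability in the generalised sense. -/

import Mathlib

open Set Filter Topology

noncomputable section

/-- The unit interval `𝒰 = [0,1]`. -/
abbrev UI : Set ℝ := Set.Icc 0 1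

/-- An expanding piecewise `C^{1+ε}` map of the unit interval, presented through its
`d` increasing full inverse branches (ordered left to right, images covering `𝒰` with
pairwise disjoint interiors), each branch being a `C^{1+ε}` diffeomorphism onto its image
whose derivative is `ε`-Hölder continuous with values in `(0,1)`. -/
structure ExpMap (d : ℕ) (ε : ℝ) : Type where
  toFun : ℝ → ℝ
  branch : Fin d → ℝ → ℝ
  branchDeriv : Fin d → ℝ → ℝ
  maps_to : Set.MapsTo toFun UI UI
  branch_maps_to : ∀ a, Set.MapsTo (branch a) UI UI
  branch_mono : ∀ a, StrictMonoOn (branch a) UI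
  right_inv : ∀ a, ∀ ξ ∈ Set.Ico (0 : ℝ) 1, toFun (branch a ξ) = ξ
  map_one : toFun 1 = 1
  branch_hasDeriv : ∀ a, ∀ ξ ∈ UI, HasDerivWithinAt (branch a) (branchDeriv a ξ) UI ξ
  branchDeriv_mem : ∀ a, ∀ ξ ∈ UI, branchDeriv a ξ ∈ Set.Ioo (0 : ℝ) 1
  branchDeriv_holder : ∀ a, ∃ C > 0, ∀ ξ ∈ UI, ∀ η ∈ UI,
      |branchDeriv a ξ - branchDeriv a η| ≤ C * |ξ - η| ^ ε
  ordered : ∀ a b : Fin d, a < b → ∀ ξ ∈ UI, ∀ η ∈ UI, branch a ξ ≤ branch b η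
  cover : UI ⊆ ⋃ a, branch a '' UI

/-- The shift map on `Σ = {1,…,d}^ℕ` (`x n` represents the letter `x_{n+1}`). -/
def shift {d : ℕ} (x : ℕ → Fin d) : ℕ → Fin d := fun n => x (n + 1)

/-- The cylinder set `[x_1 … x_n]`. -/
def cyl {d : ℕ} (x : ℕ → Fin d) (n : ℕ) : Set (ℕ → Fin d) := {y | ∀ m < n, y m = x m}

/-- Finite approximations `S_{x_1}^{-1} ∘ ⋯ ∘ S_{x_n}^{-1}(0)` to the coding map. -/
def approx {d : ℕ} {ε : ℝ} (S : ExpMap d ε) (x : ℕ → Fin d) (n : ℕ) : ℝ :=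
  (List.range n).foldr (fun m ξ => S.branch (x m) ξ) 0

/-- The coding map `π_S : Σ → 𝒰`. -/
def proj {d : ℕ} {ε : ℝ} (S : ExpMap d ε) (x : ℕ → Fin d) : ℝ := ⨆ n, approx S x n

/-- The potential `φ(x) = log (S_{x_1}^{-1})'(π_S(σ x))` associated with `S`. -/
def pot {d : ℕ} {ε : ℝ} (S : ExpMap d ε) (x : ℕ → Fin d) : ℝ :=
  Real.log (S.branchDeriv (x 0) (proj S (shift x)))

/-- Birkhoff sums `S_n f(x) = ∑_{m=0}^{n-1} f(σ^m x)`. -/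
def birk {d : ℕ} (f : (ℕ → Fin d) → ℝ) (n : ℕ) (x : ℕ → Fin d) : ℝ :=
  ∑ m ∈ Finset.range n, f (shift^[m] x)

/-- The difference quotient `D_Θ(ξ, η) = (Θ(ξ) - Θ(η))/(ξ - η)`. -/
def DQ (Θ : ℝ → ℝ) (ξ η : ℝ) : ℝ := (Θ ξ - Θ η) / (ξ - η)

/-- `Θ` is the conjugacy between `S` and `T` : an increasing homeomorphism of `𝒰`
with `T ∘ Θ = Θ ∘ S`. -/
def IsConjugacy {d : ℕ} {ε : ℝ} (S T : ExpMap d ε) (Θ : ℝ → ℝ) : Prop :=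
  StrictMonoOn Θ UI ∧ ContinuousOn Θ UI ∧ Θ '' UI = UI ∧
    ∀ ξ ∈ UI, T.toFun (Θ ξ) = Θ (S.toFun ξ)

/-- `x` has an `i`-block of length `k` at the `n`-th level:
`x_{n+1} = ⋯ = x_{n+k} = i` and `x_{n+k+1} ≠ i`. -/
def HasBlock {d : ℕ} (x : ℕ → Fin d) (i : Fin d) (k n : ℕ) : Prop :=
  (∀ m < k, x (n + m) = i) ∧ x (n + k) ≠ i

/-- `x` is eventually constant. -/
def EvConst {d : ℕ} (x : ℕ → Fin d) : Prop := ∃ N : ℕ, ∃ i : Fin d, ∀ n ≥ N, x n = i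

/-- `Θ'(ξ)` exists in the generalised sense: `lim_{η→ξ} D_Θ(ξ,η)` exists in `[0,∞]`
(with one-sided limits at the boundary points). -/
def GenDeriv (Θ : ℝ → ℝ) (ξ : ℝ) : Prop :=
  (∃ L : ℝ, Filter.Tendsto (fun η => DQ Θ ξ η) (nhdsWithin ξ (UI \ {ξ})) (nhds L)) ∨
    Filter.Tendsto (fun η => DQ Θ ξ η) (nhdsWithin ξ (UI \ {ξ})) Filter.atTop

section Branches

variable {d : ℕ} {ε : ℝ}

theorem abs_branch_sub_eq (S : ExpMap d ε) (a : Fin d) {u v : ℝ} (hu : u ∈ UI) (hv : v ∈ UI) :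
    ∃ c ∈ Set.uIcc u v, |S.branch a u - S.branch a v| = S.branchDeriv a c * |u - v| := by
  wlog huv : u ≤ v generalizing u v
  · obtain ⟨c, hc, h⟩ := this hv hu (le_of_not_ge huv)
    exact ⟨c, by rwa [Set.uIcc_comm], by rw [abs_sub_comm, h, abs_sub_comm u v]⟩
  rcases huv.eq_or_lt with rfl | hlt
  · exact ⟨u, by simp, by simp⟩
  have hsub : Set.Icc u v ⊆ UI := Set.Icc_subset_Icc hu.1 hv.2
  obtain ⟨c, hc, h⟩ := exists_hasDerivAt_eq_slope (S.branch a) (S.branchDeriv a) hlt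
    (fun z hz => (S.branch_hasDeriv a z (hsub hz)).continuousWithinAt.mono hsub)
    (fun z hz => (S.branch_hasDeriv a z (hsub ⟨hz.1.le, hz.2.le⟩)).hasDerivAt
      (Icc_mem_nhds (hu.1.trans_lt hz.1) (hz.2.trans_le hv.2)))
  refine ⟨c, by rw [Set.uIcc_of_le huv]; exact ⟨hc.1.le, hc.2.le⟩, ?_⟩
  have hm := S.branch_mono a hu hv hlt
  rw [h, abs_sub_comm, abs_of_pos (sub_pos.2 hm), abs_sub_comm u v, abs_of_pos (sub_pos.2 hlt),
    div_mul_cancel₀ _ (sub_pos.2 hlt).ne']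

theorem continuousOn_branch (S : ExpMap d ε) (a : Fin d) : ContinuousOn (S.branch a) UI :=
  fun z hz => (S.branch_hasDeriv a z hz).continuousWithinAt

theorem continuousOn_branchDeriv (hε : 0 < ε) (S : ExpMap d ε) (a : Fin d) :
    ContinuousOn (S.branchDeriv a) UI := by
  obtain ⟨C, -, h⟩ := S.branchDeriv_holder a
  intro z hz
  rw [ContinuousWithinAt, tendsto_iff_dist_tendsto_zero]
  have hlim : Tendsto (fun η : ℝ => C * |η - z| ^ ε) (𝓝[UI] z) (𝓝 0) := by
    have : Continuous (fun η : ℝ => C * |η - z| ^ ε) :=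
      continuous_const.mul ((continuous_id.sub continuous_const).abs.rpow_const
        (fun _ => Or.inr hε.le))
    have h0 := this.tendsto z
    simp only [sub_self, abs_zero, Real.zero_rpow hε.ne', mul_zero] at h0
    exact h0.mono_left nhdsWithin_le_nhds
  refine squeeze_zero' (Eventually.of_forall fun _ => dist_nonneg) ?_ hlim
  filter_upwards [self_mem_nhdsWithin] with η hη
  rw [Real.dist_eq]
  exact h η hη z hz

/-- The derivatives of the branches are uniformly bounded away from `0` and `1`. -/
theorem exists_branchDeriv_bounds (hε : 0 < ε) (S : ExpMap d ε) :
    ∃ m ∈ Set.Ioo (0 : ℝ) 1, ∃ l ∈ Set.Ioo (0 : ℝ) 1, ∀ a, ∀ z ∈ UI,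
      m ≤ S.branchDeriv a z ∧ S.branchDeriv a z ≤ l := by
  have hne : (UI).Nonempty := ⟨0, by simp⟩
  have hmin := fun a => isCompact_Icc.exists_isMinOn hne (continuousOn_branchDeriv hε S a)
  have hmax := fun a => isCompact_Icc.exists_isMaxOn hne (continuousOn_branchDeriv hε S a)
  choose p hp hpm using hmin
  choose q hq hqm using hmax
  have : Nonempty (Set.Ioo (0 : ℝ) 1) := ⟨⟨1 / 2, by norm_num⟩⟩
  obtain ⟨m, hm⟩ := Finite.exists_ge
    (fun a => (⟨S.branchDeriv a (p a), S.branchDeriv_mem a _ (hp a)⟩ : Set.Ioo (0 : ℝ) 1))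
  obtain ⟨l, hl⟩ := Finite.exists_le
    (fun a => (⟨S.branchDeriv a (q a), S.branchDeriv_mem a _ (hq a)⟩ : Set.Ioo (0 : ℝ) 1))
  exact ⟨m, m.2, l, l.2, fun a z hz =>
    ⟨le_trans (Subtype.coe_le_coe.2 (hm a)) (isMinOn_iff.1 (hpm a) z hz),
      le_trans (isMaxOn_iff.1 (hqm a) z hz) (Subtype.coe_le_coe.2 (hl a))⟩⟩

theorem exists_branchDeriv_distortion (hε : 0 < ε) (S : ExpMap d ε) :
    ∃ C, 0 ≤ C ∧ ∀ a, ∀ z ∈ UI, ∀ w ∈ UI,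
      S.branchDeriv a z ≤ Real.exp (C * |z - w| ^ ε) * S.branchDeriv a w := by
  obtain ⟨m, hm, l, -, hb⟩ := exists_branchDeriv_bounds hε S
  choose C hC h using S.branchDeriv_holder
  obtain ⟨M, hM⟩ := Finite.exists_le C
  refine ⟨max M 0 / m, div_nonneg (le_max_right _ _) hm.1.le, fun a z hz w hw => ?_⟩
  have hw0 := (S.branchDeriv_mem a w hw).1
  have ht : 0 ≤ |z - w| ^ ε := Real.rpow_nonneg (abs_nonneg _) _
  have h1 : S.branchDeriv a z - S.branchDeriv a w ≤ max M 0 * |z - w| ^ ε :=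
    (le_abs_self _).trans ((h a z hz w hw).trans
      (mul_le_mul_of_nonneg_right ((hM a).trans (le_max_left _ _)) ht))
  have h2 : max M 0 * |z - w| ^ ε ≤ max M 0 / m * |z - w| ^ ε * S.branchDeriv a w := by
    have hr : 1 ≤ S.branchDeriv a w / m := (one_le_div hm.1).2 (hb a w hw).1
    calc max M 0 * |z - w| ^ ε ≤ max M 0 * |z - w| ^ ε * (S.branchDeriv a w / m) :=
          le_mul_of_one_le_right (mul_nonneg (le_max_right _ _) ht) hr
      _ = _ := by ring
  have h3 := Real.add_one_le_exp (max M 0 / m * |z - w| ^ ε)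
  nlinarith

theorem branch_sub_distortion (S : ExpMap d ε) (hε : 0 < ε) {C : ℝ} (hC : 0 ≤ C)
    (h : ∀ a, ∀ z ∈ UI, ∀ w ∈ UI,
      S.branchDeriv a z ≤ Real.exp (C * |z - w| ^ ε) * S.branchDeriv a w)
    (a : Fin d) {u v z δ : ℝ} (hu : u ∈ UI) (hv : v ∈ UI) (hz : z ∈ UI)
    (huz : |u - z| ≤ δ) (hvz : |v - z| ≤ δ) :
    S.branchDeriv a z * |u - v| ≤ Real.exp (C * δ ^ ε) * |S.branch a u - S.branch a v| ∧
      |S.branch a u - S.branch a v| ≤ Real.exp (C * δ ^ ε) * (S.branchDeriv a z * |u - v|) := by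
  obtain ⟨c, hc, he⟩ := abs_branch_sub_eq S a hu hv
  have hcU : c ∈ UI := (Set.ordConnected_Icc.uIcc_subset hu hv) hc
  have hcz : |c - z| ≤ δ := by
    rw [abs_le] at huz hvz ⊢
    rcases Set.mem_uIcc.1 hc with hc | hc <;> constructor <;> linarith [hc.1, hc.2]
  have hexp : Real.exp (C * |c - z| ^ ε) ≤ Real.exp (C * δ ^ ε) :=
    Real.exp_le_exp.2 (mul_le_mul_of_nonneg_left
      (Real.rpow_le_rpow (abs_nonneg _) hcz hε.le) hC)
  have h1 := h a c hcU z hz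
  have h2 := h a z hz c hcU
  rw [abs_sub_comm z c] at h2
  have hz0 := (S.branchDeriv_mem a z hz).1
  have hc0 := (S.branchDeriv_mem a c hcU).1
  rw [he, ← mul_assoc, ← mul_assoc]
  exact ⟨mul_le_mul_of_nonneg_right (h2.trans (mul_le_mul_of_nonneg_right hexp hc0.le))
      (abs_nonneg _),
    mul_le_mul_of_nonneg_right (h1.trans (mul_le_mul_of_nonneg_right hexp hz0.le))
      (abs_nonneg _)⟩

/-- The composition `S_{x_1}^{-1} ∘ ⋯ ∘ S_{x_n}^{-1}`. -/
def branchComp (S : ExpMap d ε) : ℕ → (ℕ → Fin d) → ℝ → ℝ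
  | 0, _, u => u
  | n + 1, x, u => S.branch (x 0) (branchComp S n (shift x) u)

theorem shift_iterate_apply (x : ℕ → Fin d) (n m : ℕ) : shift^[n] x m = x (m + n) := by
  induction n generalizing m with
  | zero => rfl
  | succ n ih => rw [Function.iterate_succ_apply', shift, ih]; congr 1; ring

theorem branchComp_succ' (S : ExpMap d ε) (n : ℕ) (x : ℕ → Fin d) (u : ℝ) :
    branchComp S (n + 1) x u = branchComp S n x (S.branch (x n) u) := by
  induction n generalizing x with
  | zero => rfl
  | succ n ih =>
    rw [branchComp, ih (shift x)]
    rfl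

theorem branchComp_add (S : ExpMap d ε) (n k : ℕ) (x : ℕ → Fin d) (u : ℝ) :
    branchComp S (n + k) x u = branchComp S n x (branchComp S k (shift^[n] x) u) := by
  induction n generalizing x with
  | zero => rw [zero_add]; rfl
  | succ n ih => rw [Nat.succ_add, branchComp, ih (shift x)]; rfl

theorem approx_eq_branchComp (S : ExpMap d ε) (x : ℕ → Fin d) (n : ℕ) :
    approx S x n = branchComp S n x 0 := by
  have : ∀ u, (List.range n).foldr (fun m ξ => S.branch (x m) ξ) u = branchComp S n x u := by
    induction n with
    | zero => intro u; rfl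
    | succ n ih =>
      intro u
      rw [List.range_succ, List.foldr_append, ih, branchComp_succ']
      rfl
  exact this 0

theorem branchComp_mem (S : ExpMap d ε) (n : ℕ) (x : ℕ → Fin d) {u : ℝ} (hu : u ∈ UI) :
    branchComp S n x u ∈ UI := by
  induction n generalizing x with
  | zero => exact hu
  | succ n ih => exact S.branch_maps_to _ (ih _)

theorem branchComp_strictMonoOn (S : ExpMap d ε) (n : ℕ) (x : ℕ → Fin d) :
    StrictMonoOn (branchComp S n x) UI := by
  induction n generalizing x with
  | zero => exact fun _ _ _ _ h => h
  | succ n ih =>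
    exact fun u hu v hv h => S.branch_mono _ (branchComp_mem S n _ hu) (branchComp_mem S n _ hv)
      (ih _ hu hv h)

theorem continuousOn_branchComp (S : ExpMap d ε) (n : ℕ) (x : ℕ → Fin d) :
    ContinuousOn (branchComp S n x) UI := by
  induction n generalizing x with
  | zero => exact continuousOn_id
  | succ n ih =>
    exact (continuousOn_branch S _).comp (ih _) (fun u hu => branchComp_mem S n _ hu)

theorem abs_branch_sub_bounds (S : ExpMap d ε) {m l : ℝ}
    (hb : ∀ a, ∀ z ∈ UI, m ≤ S.branchDeriv a z ∧ S.branchDeriv a z ≤ l)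
    (a : Fin d) {u v : ℝ} (hu : u ∈ UI) (hv : v ∈ UI) :
    m * |u - v| ≤ |S.branch a u - S.branch a v| ∧
      |S.branch a u - S.branch a v| ≤ l * |u - v| := by
  obtain ⟨c, hc, he⟩ := abs_branch_sub_eq S a hu hv
  have hcU : c ∈ UI := (Set.ordConnected_Icc.uIcc_subset hu hv) hc
  rw [he]
  exact ⟨mul_le_mul_of_nonneg_right (hb a c hcU).1 (abs_nonneg _),
    mul_le_mul_of_nonneg_right (hb a c hcU).2 (abs_nonneg _)⟩

theorem abs_sub_le_one {u v : ℝ} (hu : u ∈ UI) (hv : v ∈ UI) : |u - v| ≤ 1 := by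
  rw [abs_le]; constructor <;> linarith [hu.1, hu.2, hv.1, hv.2]

theorem abs_branchComp_sub_le (S : ExpMap d ε) {m l : ℝ} (hl : 0 ≤ l)
    (hb : ∀ a, ∀ z ∈ UI, m ≤ S.branchDeriv a z ∧ S.branchDeriv a z ≤ l)
    (n : ℕ) (x : ℕ → Fin d) {u v : ℝ} (hu : u ∈ UI) (hv : v ∈ UI) :
    |branchComp S n x u - branchComp S n x v| ≤ l ^ n := by
  induction n generalizing x with
  | zero => simpa [branchComp] using abs_sub_le_one hu hv
  | succ n ih =>
    refine (abs_branch_sub_bounds S hb _ (branchComp_mem S n _ hu)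
      (branchComp_mem S n _ hv)).2.trans ?_
    rw [pow_succ, mul_comm]
    exact mul_le_mul_of_nonneg_right (ih _) hl

theorem tendsto_approx (S : ExpMap d ε) (x : ℕ → Fin d) :
    Tendsto (approx S x) atTop (𝓝 (proj S x)) := by
  have h0 : (0 : ℝ) ∈ UI := by simp
  have hmono : Monotone (approx S x) := by
    refine monotone_nat_of_le_succ fun n => ?_
    rw [approx_eq_branchComp, approx_eq_branchComp, branchComp_succ']
    exact (branchComp_strictMonoOn S n x).monotoneOn h0 (S.branch_maps_to _ h0)
      (S.branch_maps_to _ h0).1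
  refine tendsto_atTop_ciSup hmono ⟨1, ?_⟩
  rintro _ ⟨n, rfl⟩
  rw [approx_eq_branchComp]
  exact (branchComp_mem S n x h0).2

theorem proj_mem (S : ExpMap d ε) (x : ℕ → Fin d) : proj S x ∈ UI :=
  isClosed_Icc.mem_of_tendsto (tendsto_approx S x)
    (Eventually.of_forall fun n => by
      rw [approx_eq_branchComp]; exact branchComp_mem S n x (by simp))

theorem tendsto_comp_approx (S : ExpMap d ε) (x : ℕ → Fin d) {f : ℝ → ℝ}
    (hf : ContinuousOn f UI) : Tendsto (fun n => f (approx S x n)) atTop (𝓝 (f (proj S x))) :=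
  (hf _ (proj_mem S x)).tendsto.comp (tendsto_nhdsWithin_iff.2 ⟨tendsto_approx S x,
    Eventually.of_forall fun n => by
      rw [approx_eq_branchComp]; exact branchComp_mem S n x (by simp)⟩)

theorem proj_eq_branch (S : ExpMap d ε) (x : ℕ → Fin d) :
    proj S x = S.branch (x 0) (proj S (shift x)) := by
  refine tendsto_nhds_unique ((tendsto_add_atTop_iff_nat 1).2 (tendsto_approx S x)) ?_
  refine (tendsto_comp_approx S (shift x) (continuousOn_branch S (x 0))).congr fun n => ?_
  rw [approx_eq_branchComp, approx_eq_branchComp]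
  rfl

theorem proj_eq_branchComp (S : ExpMap d ε) (n : ℕ) (x : ℕ → Fin d) :
    proj S x = branchComp S n x (proj S (shift^[n] x)) := by
  induction n generalizing x with
  | zero => rfl
  | succ n ih => rw [proj_eq_branch, ih (shift x)]; rfl

theorem birk_succ (f : (ℕ → Fin d) → ℝ) (n : ℕ) (x : ℕ → Fin d) :
    birk f (n + 1) x = f x + birk f n (shift x) := by
  rw [birk, Finset.sum_range_succ', add_comm]
  rfl

theorem birk_add (f : (ℕ → Fin d) → ℝ) (n k : ℕ) (x : ℕ → Fin d) :
    birk f (n + k) x = birk f n x + birk f k (shift^[n] x) := by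
  simp only [birk, Finset.sum_range_add, ← Function.iterate_add_apply, add_comm _ n]

theorem birk_sub (f g : (ℕ → Fin d) → ℝ) (n : ℕ) (x : ℕ → Fin d) :
    birk (fun z => f z - g z) n x = birk f n x - birk g n x :=
  Finset.sum_sub_distrib _ _

theorem exp_pot (S : ExpMap d ε) (x : ℕ → Fin d) :
    Real.exp (pot S x) = S.branchDeriv (x 0) (proj S (shift x)) :=
  Real.exp_log (S.branchDeriv_mem _ _ (proj_mem S _)).1

theorem pot_neg (S : ExpMap d ε) (x : ℕ → Fin d) : pot S x < 0 :=
  Real.log_neg (S.branchDeriv_mem _ _ (proj_mem S _)).1 (S.branchDeriv_mem _ _ (proj_mem S _)).2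

/-- Bounded distortion: compositions of branches act, up to a uniform constant, as homotheties. -/
theorem exists_distortion (hε : 0 < ε) (S : ExpMap d ε) :
    ∃ K, 0 < K ∧ ∀ (n : ℕ) (x : ℕ → Fin d), ∀ u ∈ UI, ∀ v ∈ UI,
      Real.exp (birk (pot S) n x) * |u - v| ≤ K * |branchComp S n x u - branchComp S n x v| ∧
      |branchComp S n x u - branchComp S n x v| ≤
        K * (Real.exp (birk (pot S) n x) * |u - v|) := by
  obtain ⟨m, hm, l, hl, hb⟩ := exists_branchDeriv_bounds hε S
  obtain ⟨C, hC, hdist⟩ := exists_branchDeriv_distortion hε S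
  have key : ∀ (n : ℕ) (x : ℕ → Fin d), ∀ u ∈ UI, ∀ v ∈ UI,
      Real.exp (birk (pot S) n x) * |u - v| ≤
        Real.exp (C * ∑ j ∈ Finset.range n, (l ^ ε) ^ j) *
          |branchComp S n x u - branchComp S n x v| ∧
      |branchComp S n x u - branchComp S n x v| ≤
        Real.exp (C * ∑ j ∈ Finset.range n, (l ^ ε) ^ j) *
          (Real.exp (birk (pot S) n x) * |u - v|) := by
    intro n
    induction n with
    | zero => intro x u hu v hv; simp [birk, branchComp]
    | succ n ih =>
      intro x u hu v hv
      have hz : ∀ w ∈ UI, |branchComp S n (shift x) w - proj S (shift x)| ≤ l ^ n := by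
        intro w hw
        rw [proj_eq_branchComp S n (shift x)]
        exact abs_branchComp_sub_le S hl.1.le hb n _ hw (proj_mem S _)
      obtain ⟨h1, h2⟩ := branch_sub_distortion S hε hC hdist (x 0) (branchComp_mem S n (shift x) hu)
        (branchComp_mem S n (shift x) hv) (proj_mem S (shift x)) (hz u hu) (hz v hv)
      obtain ⟨i1, i2⟩ := ih (shift x) u hu v hv
      have hpow : (l ^ n) ^ ε = (l ^ ε) ^ n := by
        rw [← Real.rpow_natCast l n, ← Real.rpow_mul hl.1.le, mul_comm, Real.rpow_mul hl.1.le,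
          Real.rpow_natCast]
      rw [hpow, ← exp_pot] at h1 h2
      rw [birk_succ, Finset.sum_range_succ, mul_add, Real.exp_add, Real.exp_add]
      simp only [branchComp]
      set E₁ := Real.exp (C * ∑ j ∈ Finset.range n, (l ^ ε) ^ j)
      set E₂ := Real.exp (C * (l ^ ε) ^ n)
      have hE₁ : 0 ≤ E₁ := (Real.exp_pos _).le
      have hE₂ : 0 ≤ E₂ := (Real.exp_pos _).le
      have hP : 0 ≤ Real.exp (pot S x) := (Real.exp_pos _).le
      constructor
      · calc _ = Real.exp (pot S x) * (Real.exp (birk (pot S) n (shift x)) * |u - v|) := by ring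
          _ ≤ Real.exp (pot S x) *
              (E₁ * |branchComp S n (shift x) u - branchComp S n (shift x) v|) := by gcongr
          _ = E₁ * (Real.exp (pot S x) *
              |branchComp S n (shift x) u - branchComp S n (shift x) v|) := by ring
          _ ≤ E₁ * (E₂ * _) := by gcongr
          _ = _ := by ring
      · calc _ ≤ E₂ * (Real.exp (pot S x) *
              |branchComp S n (shift x) u - branchComp S n (shift x) v|) := h2
          _ ≤ E₂ * (Real.exp (pot S x) *
              (E₁ * (Real.exp (birk (pot S) n (shift x)) * |u - v|))) := by gcongr
          _ = _ := by ring
  have hlt : l ^ ε < 1 := Real.rpow_lt_one hl.1.le hl.2 hε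
  have hl0 : 0 ≤ l ^ ε := Real.rpow_nonneg hl.1.le _
  refine ⟨Real.exp (C * (1 - l ^ ε)⁻¹), Real.exp_pos _, fun n x u hu v hv => ?_⟩
  have hexp : Real.exp (C * ∑ j ∈ Finset.range n, (l ^ ε) ^ j) ≤
      Real.exp (C * (1 - l ^ ε)⁻¹) := by
    refine Real.exp_le_exp.2 (mul_le_mul_of_nonneg_left ?_ hC)
    rw [← tsum_geometric_of_lt_one hl0 hlt]
    exact (summable_geometric_of_lt_one hl0 hlt).sum_le_tsum _ (fun j _ => pow_nonneg hl0 j)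
  obtain ⟨h1, h2⟩ := key n x u hu v hv
  exact ⟨h1.trans (by gcongr), h2.trans (by gcongr)⟩

/-- `K` bounds the distortion of all compositions of branches of `S`, and each branch contracts
by a factor of at most `K`. -/
structure DistortionBound (S : ExpMap d ε) (K : ℝ) : Prop where
  one_le : 1 ≤ K
  lower : ∀ (n : ℕ) (x : ℕ → Fin d), ∀ u ∈ UI, ∀ v ∈ UI,
    Real.exp (birk (pot S) n x) * |u - v| ≤ K * |branchComp S n x u - branchComp S n x v|
  upper : ∀ (n : ℕ) (x : ℕ → Fin d), ∀ u ∈ UI, ∀ v ∈ UI,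
    |branchComp S n x u - branchComp S n x v| ≤ K * (Real.exp (birk (pot S) n x) * |u - v|)
  branch_lower : ∀ a, ∀ u ∈ UI, ∀ v ∈ UI, |u - v| ≤ K * |S.branch a u - S.branch a v|

theorem DistortionBound.mono {S : ExpMap d ε} {K L : ℝ} (h : DistortionBound S K) (hKL : K ≤ L) :
    DistortionBound S L where
  one_le := h.one_le.trans hKL
  lower n x u hu v hv := (h.lower n x u hu v hv).trans (by gcongr)
  upper n x u hu v hv := (h.upper n x u hu v hv).trans (by gcongr)
  branch_lower a u hu v hv := (h.branch_lower a u hu v hv).trans (by gcongr)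

theorem exists_distortionBound (hε : 0 < ε) (S : ExpMap d ε) : ∃ K, DistortionBound S K := by
  obtain ⟨m, hm, l, hl, hb⟩ := exists_branchDeriv_bounds hε S
  obtain ⟨K, hK, h⟩ := exists_distortion hε S
  have hm' := inv_pos.2 hm.1
  refine ⟨K + 1 + m⁻¹, by linarith, ?_, ?_, ?_⟩
  · intro n x u hu v hv
    refine (h n x u hu v hv).1.trans ?_
    gcongr
    linarith
  · intro n x u hu v hv
    refine (h n x u hu v hv).2.trans ?_
    gcongr
    linarith
  · intro a u hu v hv
    have h1 := (abs_branch_sub_bounds S hb a hu hv).1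
    rw [← le_inv_mul_iff₀ hm.1] at h1
    refine h1.trans ?_
    gcongr
    linarith

theorem abs_branch_sub_le (S : ExpMap d ε) (a : Fin d) {u v : ℝ} (hu : u ∈ UI) (hv : v ∈ UI) :
    |S.branch a u - S.branch a v| ≤ |u - v| := by
  obtain ⟨c, hc, he⟩ := abs_branch_sub_eq S a hu hv
  rw [he]
  exact mul_le_of_le_one_left (abs_nonneg _)
    (S.branchDeriv_mem a c (Set.ordConnected_Icc.uIcc_subset hu hv hc)).2.le

/-- `q` is an endpoint of the unit interval and `i` the letter of the branch fixing it. -/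
def IsEnd (i : Fin d) (q : ℝ) : Prop := (i.val = 0 ∧ q = 0) ∨ (i.val = d - 1 ∧ q = 1)

theorem IsEnd.mem {i : Fin d} {q : ℝ} (h : IsEnd i q) : q ∈ UI := by
  rcases h with ⟨-, rfl⟩ | ⟨-, rfl⟩ <;> simp

theorem IsEnd.branch_eq {i : Fin d} {q : ℝ} (h : IsEnd i q) (S : ExpMap d ε) :
    S.branch i q = q := by
  obtain ⟨b, t, ht, he⟩ := Set.mem_iUnion.1 (S.cover h.mem)
  have hq := S.branch_maps_to i h.mem
  rcases h with ⟨hi, rfl⟩ | ⟨hi, rfl⟩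
  · refine le_antisymm ?_ hq.1
    rcases eq_or_ne i b with rfl | hne
    · exact ((S.branch_mono i).monotoneOn (by simp) ht ht.1).trans he.le
    · exact (S.ordered i b (by omega) 0 (by simp) t ht).trans he.le
  · refine le_antisymm hq.2 ?_
    rcases eq_or_ne i b with rfl | hne
    · exact he.ge.trans ((S.branch_mono i).monotoneOn ht (by simp) ht.2)
    · exact he.ge.trans (S.ordered b i (by omega) t ht 1 (by simp))

theorem IsEnd.one_le_mul_abs_sub {i : Fin d} {q : ℝ} (h : IsEnd i q) {S : ExpMap d ε} {K : ℝ}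
    (hK : DistortionBound S K) {j : Fin d} (hj : j ≠ i) {t : ℝ} (ht : t ∈ UI) :
    1 ≤ K * |S.branch j t - q| := by
  have hK0 := hK.one_le
  have hb := hK.branch_lower i 0 (by simp) 1 (by simp)
  have hq := h.branch_eq S
  simp only [zero_sub, abs_neg, abs_one] at hb
  refine hb.trans ?_
  have hm := (S.branch_mono i).monotoneOn (a := 0) (by simp) (b := 1) (by simp) zero_le_one
  refine mul_le_mul_of_nonneg_left ?_ (zero_le_one.trans hK0)
  rw [abs_sub_comm, abs_of_nonneg (sub_nonneg.2 hm)]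
  rcases h with ⟨hi, rfl⟩ | ⟨hi, rfl⟩
  · have := S.ordered i j (by omega) 1 (by simp) t ht
    exact le_trans (by linarith) (le_abs_self _)
  · have := S.ordered j i (by omega) t ht 0 (by simp)
    rw [abs_sub_comm]
    exact le_trans (by linarith) (le_abs_self _)

theorem branch_one_eq_branch_zero (S : ExpMap d ε) {a b : Fin d} (hab : a.val + 1 = b.val) :
    S.branch a 1 = S.branch b 0 := by
  have h0 : (0 : ℝ) ∈ UI := by simp
  have h1 : (1 : ℝ) ∈ UI := by simp
  refine le_antisymm (S.ordered a b (by omega) 1 h1 0 h0) ?_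
  by_contra! hlt
  have ha := S.branch_maps_to a h1
  have hb := S.branch_maps_to b h0
  obtain ⟨j, t, ht, he⟩ := Set.mem_iUnion.1 (S.cover
    (show (S.branch a 1 + S.branch b 0) / 2 ∈ UI from
      ⟨by linarith [ha.1, hb.1], by linarith [ha.2, hb.2]⟩))
  rcases lt_trichotomy j a with hja | rfl | hja
  · linarith [S.ordered j a hja t ht 1 h1]
  · linarith [(S.branch_mono j).monotoneOn ht h1 ht.2]
  · rcases eq_or_ne j b with rfl | hjb
    · linarith [(S.branch_mono j).monotoneOn h0 ht ht.1]
    · linarith [S.ordered b j (by omega) 0 h0 t ht]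

theorem branchComp_isEnd (S : ExpMap d ε) {i : Fin d} {q : ℝ} (h : IsEnd i q) (n : ℕ)
    (x : ℕ → Fin d) (hx : ∀ j < n, x j = i) : branchComp S n x q = q := by
  induction n generalizing x with
  | zero => rfl
  | succ n ih =>
    rw [branchComp, ih (shift x) (fun j hj => hx (j + 1) (by omega)), hx 0 (by omega), h.branch_eq]

/-- Every point other than `proj S x` leaves the cylinders of `x` at some level. -/
theorem exists_exit (hε : 0 < ε) (S : ExpMap d ε) (x : ℕ → Fin d) {η : ℝ} (hη : η ∈ UI)
    (hne : η ≠ proj S x) :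
    ∃ n, ∃ j ≠ x n, ∃ t ∈ UI, η = branchComp S n x (S.branch j t) := by
  obtain ⟨m, hm, l, hl, hb⟩ := exists_branchDeriv_bounds hε S
  have hex : ∃ n, η ∉ branchComp S n x '' UI := by
    by_contra! hall
    refine hne (sub_eq_zero.1 (abs_eq_zero.1 (le_antisymm ?_ (abs_nonneg _))))
    refine ge_of_tendsto (tendsto_pow_atTop_nhds_zero_of_lt_one hl.1.le hl.2)
      (Eventually.of_forall fun n => ?_)
    obtain ⟨v, hv, rfl⟩ := hall n
    rw [proj_eq_branchComp S n x]
    exact abs_branchComp_sub_le S hl.1.le hb n x hv (proj_mem S _)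
  classical
  obtain ⟨n, hn⟩ : ∃ n, Nat.find hex = n + 1 := by
    refine Nat.exists_eq_succ_of_ne_zero fun h0 => ?_
    have := Nat.find_spec hex
    rw [h0] at this
    exact this ⟨η, hη, rfl⟩
  have hout := Nat.find_spec hex
  rw [hn] at hout
  obtain ⟨v, hv, rfl⟩ := not_not.1 (Nat.find_min hex (m := n) (by omega))
  obtain ⟨j, t, ht, rfl⟩ := Set.mem_iUnion.1 (S.cover hv)
  refine ⟨n, j, ?_, t, ht, rfl⟩
  rintro rfl
  exact hout ⟨t, ht, branchComp_succ' S n x t⟩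

theorem IsEnd.proj_const (hε : 0 < ε) {i : Fin d} {q : ℝ} (h : IsEnd i q) (S : ExpMap d ε) :
    proj S (fun _ => i) = q := by
  obtain ⟨m, hm, l, hl, hb⟩ := exists_branchDeriv_bounds hε S
  have h1 : proj S (fun _ => i) = S.branch i (proj S (fun _ => i)) := proj_eq_branch S _
  have h2 := (abs_branch_sub_bounds S hb i (proj_mem S (fun _ => i)) h.mem).2
  rw [← h1, h.branch_eq] at h2
  have h3 := abs_nonneg (proj S (fun _ => i) - q)
  have : |proj S (fun _ => i) - q| = 0 := by nlinarith [hl.2]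
  exact sub_eq_zero.1 (abs_eq_zero.1 this)

theorem birk_const (f : (ℕ → Fin d) → ℝ) (n : ℕ) (i : Fin d) :
    birk f n (fun _ => i) = n * f (fun _ => i) := by
  induction n with
  | zero => simp [birk]
  | succ n ih =>
    rw [birk_succ]
    change _ + birk f n (fun _ => i) = _
    rw [ih]; push_cast; ring

theorem not_evConst_shift {x : ℕ → Fin d} (hx : ¬ EvConst x) : ¬ EvConst (shift x) := by
  rintro ⟨N, i, h⟩
  refine hx ⟨N + 1, i, fun n hn => ?_⟩
  obtain ⟨k, rfl⟩ := Nat.exists_eq_add_of_le' (show 1 ≤ n by omega)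
  exact h k (by omega)

theorem not_evConst_shift_iterate {x : ℕ → Fin d} (hx : ¬ EvConst x) (n : ℕ) :
    ¬ EvConst (shift^[n] x) := by
  induction n with
  | zero => exact hx
  | succ n ih => rw [Function.iterate_succ_apply']; exact not_evConst_shift ih

/-- A sequence that is not eventually constant leaves every block of a given letter. -/
theorem exists_block_end {x : ℕ → Fin d} (hx : ¬ EvConst x) (i : Fin d) :
    ∃ k, HasBlock x i k 0 := by
  have hex : ∃ k, x k ≠ i := by
    by_contra! h
    exact hx ⟨0, i, fun n _ => h n⟩
  classical
  refine ⟨Nat.find hex, fun m hm => ?_, by simpa using Nat.find_spec hex⟩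
  simpa using Nat.find_min hex hm

theorem proj_ne_isEnd (hε : 0 < ε) (S : ExpMap d ε) {x : ℕ → Fin d} (hx : ¬ EvConst x)
    {i : Fin d} {q : ℝ} (h : IsEnd i q) : proj S x ≠ q := by
  obtain ⟨K, hK⟩ := exists_distortionBound hε S
  obtain ⟨k, hk, hk'⟩ := exists_block_end hx i
  intro he
  simp only [zero_add] at hk hk'
  have h1 : branchComp S k x (proj S (shift^[k] x)) = branchComp S k x q := by
    rw [← proj_eq_branchComp, he, branchComp_isEnd S h k x hk]
  have h2 := (branchComp_strictMonoOn S k x).injOn (proj_mem S _) h.mem h1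
  rw [proj_eq_branch, shift_iterate_apply, zero_add] at h2
  have h3 := h.one_le_mul_abs_sub hK hk' (proj_mem S (shift (shift^[k] x)))
  rw [h2] at h3
  simp at h3
  linarith

/-- Two points in distinct first-level intervals are separated by an endpoint `p` of the interval
containing the first one, and `p` is also an endpoint of a neighbouring interval. -/
theorem exists_separating_end (hd : 2 ≤ d) (S : ExpMap d ε) {a j : Fin d} (hj : j ≠ a) {s t : ℝ}
    (hs : s ∈ UI) (ht : t ∈ UI) :
    ∃ (i : Fin d) (q : ℝ) (i' : Fin d), IsEnd i q ∧ IsEnd i' (1 - q) ∧ ∃ b, S.branch b (1 - q) = S.branch a q ∧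
      |S.branch a s - S.branch j t| =
        |S.branch a s - S.branch a q| + |S.branch a q - S.branch j t| ∧
      (j = b ∨ |S.branch b q - S.branch b (1 - q)| ≤ |S.branch a q - S.branch j t|) := by
  have h0 : (0 : ℝ) ∈ UI := by simp
  have h1 : (1 : ℝ) ∈ UI := by simp
  rcases lt_or_gt_of_ne hj with hlt | hlt
  · let b : Fin d := ⟨a.val - 1, by omega⟩
    have hba : S.branch b 1 = S.branch a 0 :=
      branch_one_eq_branch_zero S (show a.val - 1 + 1 = a.val by omega)
    have hs0 := (S.branch_mono a).monotoneOn h0 hs hs.1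
    have hjt := S.ordered j a hlt t ht 0 h0
    refine ⟨⟨0, by omega⟩, 0, ⟨d - 1, by omega⟩, Or.inl ⟨rfl, rfl⟩, Or.inr ⟨rfl, by norm_num⟩,
      b, by rwa [sub_zero], ?_, ?_⟩
    · rw [abs_of_nonneg (sub_nonneg.2 hs0), abs_of_nonneg (sub_nonneg.2 hjt),
        abs_of_nonneg (by linarith)]
      ring
    · refine or_iff_not_imp_left.2 fun hne => ?_
      have hjb := S.ordered j b (show j.val < a.val - 1 from by
        have : j.val ≠ a.val - 1 := fun h => hne (Fin.ext h)
        omega) t ht 0 h0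
      have hb := (S.branch_mono b).monotoneOn h0 h1 zero_le_one
      rw [sub_zero, abs_sub_comm, abs_of_nonneg (by linarith), abs_of_nonneg (by linarith)]
      linarith
  · let b : Fin d := ⟨a.val + 1, by omega⟩
    have hba : S.branch a 1 = S.branch b 0 := branch_one_eq_branch_zero S rfl
    have hs0 := (S.branch_mono a).monotoneOn hs h1 hs.2
    have hjt := S.ordered a j hlt 1 h1 t ht
    refine ⟨⟨d - 1, by omega⟩, 1, ⟨0, by omega⟩, Or.inr ⟨rfl, rfl⟩, Or.inl ⟨rfl, by norm_num⟩,
      b, by rw [sub_self, hba], ?_, ?_⟩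
    · rw [abs_of_nonpos (sub_nonpos.2 hs0), abs_of_nonpos (sub_nonpos.2 hjt),
        abs_of_nonpos (by linarith)]
      ring
    · refine or_iff_not_imp_left.2 fun hne => ?_
      have hjb := S.ordered b j (show a.val + 1 < j.val from by
        have : j.val ≠ a.val + 1 := fun h => hne (Fin.ext h)
        omega) 1 h1 t ht
      have hb := (S.branch_mono b).monotoneOn h0 h1 zero_le_one
      rw [sub_self, abs_of_nonneg (by linarith), abs_sub_comm, abs_of_nonneg (by linarith)]
      linarith

/-! ### The conjugacy -/

theorem IsConjugacy.mem {S T : ExpMap d ε} {Θ : ℝ → ℝ} (h : IsConjugacy S T Θ) {u : ℝ}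
    (hu : u ∈ UI) : Θ u ∈ UI :=
  h.2.2.1 ▸ Set.mem_image_of_mem Θ hu

theorem IsConjugacy.isEnd {S T : ExpMap d ε} {Θ : ℝ → ℝ} (h : IsConjugacy S T Θ) {i : Fin d}
    {q : ℝ} (hq : IsEnd i q) : Θ q = q := by
  have hm := h.mem hq.mem
  obtain ⟨t, ht, he⟩ : q ∈ Θ '' UI := by rw [h.2.2.1]; exact hq.mem
  rcases hq with ⟨-, rfl⟩ | ⟨-, rfl⟩
  · exact le_antisymm ((h.1.monotoneOn (by simp) ht ht.1).trans he.le) hm.1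
  · exact le_antisymm hm.2 (he.ge.trans (h.1.monotoneOn ht (by simp) ht.2))

theorem IsConjugacy.branch_of_lt {S T : ExpMap d ε} {Θ : ℝ → ℝ} (h : IsConjugacy S T Θ)
    {u : ℝ} (hu : u ∈ Set.Ico (0 : ℝ) 1) (a : Fin d) :
    Θ (S.branch a u) = T.branch a (Θ u) := by
  have h1 : (1 : ℝ) ∈ UI := by simp
  have hu' : u ∈ UI := ⟨hu.1, hu.2.le⟩
  have hw : Θ u < 1 := (h.1 hu' h1 hu.2).trans_le (h.mem h1).2
  have hex : ∀ a, ∃ b, Θ (S.branch a u) = T.branch b (Θ u) := by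
    intro a
    have hT := h.2.2.2 _ (S.branch_maps_to a hu')
    rw [S.right_inv a u hu] at hT
    obtain ⟨b, z, hz, he⟩ := Set.mem_iUnion.1 (T.cover (h.mem (S.branch_maps_to a hu')))
    rw [← he] at hT ⊢
    rcases hz.2.lt_or_eq with hlt | rfl
    · rw [T.right_inv b z ⟨hz.1, hlt⟩] at hT
      exact ⟨b, by rw [hT]⟩
    · by_cases hb : b.val = d - 1
      · rw [IsEnd.branch_eq (Or.inr ⟨hb, rfl⟩) T, T.map_one] at hT
        exact absurd hT.symm hw.ne
      · have hb' : T.branch b 1 = T.branch ⟨b.val + 1, by omega⟩ 0 :=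
          branch_one_eq_branch_zero T rfl
        rw [hb', T.right_inv _ 0 (by simp)] at hT
        exact ⟨⟨b.val + 1, by omega⟩, by rw [← hT, hb']⟩
  choose f hf using hex
  have hmono : StrictMono f := by
    intro a a' haa
    have hlt : S.branch a u < S.branch a' u :=
      (S.branch_mono a hu' h1 hu.2).trans_le (S.ordered a a' haa 1 h1 u hu')
    have hΘ := h.1 (S.branch_maps_to a hu') (S.branch_maps_to a' hu') hlt
    rw [hf, hf] at hΘ
    by_contra! hle
    rcases hle.eq_or_lt with he | hl
    · rw [he] at hΘ; exact hΘ.false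
    · exact hΘ.not_ge (T.ordered _ _ hl _ (h.mem hu') _ (h.mem hu'))
  have hid : f = id := hmono.eq_id
  rw [hf, hid, id]

theorem IsConjugacy.branch {S T : ExpMap d ε} {Θ : ℝ → ℝ} (h : IsConjugacy S T Θ)
    {u : ℝ} (hu : u ∈ UI) (a : Fin d) : Θ (S.branch a u) = T.branch a (Θ u) := by
  rcases hu.2.lt_or_eq with hlt | rfl
  · exact h.branch_of_lt ⟨hu.1, hlt⟩ a
  have hΘ1 : Θ 1 = 1 := h.isEnd (i := ⟨d - 1, by have := a.2; omega⟩) (Or.inr ⟨rfl, rfl⟩)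
  have hΘ0 : Θ 0 = 0 := h.isEnd (i := ⟨0, by have := a.2; omega⟩) (Or.inl ⟨rfl, rfl⟩)
  by_cases ha : a.val = d - 1
  · have he : IsEnd a 1 := Or.inr ⟨ha, rfl⟩
    rw [he.branch_eq S, hΘ1, he.branch_eq T]
  · have hb : a.val + 1 = (⟨a.val + 1, by omega⟩ : Fin d).val := rfl
    rw [branch_one_eq_branch_zero S hb, h.branch_of_lt (by simp), hΘ0, hΘ1,
      branch_one_eq_branch_zero T hb]

theorem IsConjugacy.branchComp {S T : ExpMap d ε} {Θ : ℝ → ℝ} (h : IsConjugacy S T Θ)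
    (n : ℕ) (x : ℕ → Fin d) {u : ℝ} (hu : u ∈ UI) :
    Θ (branchComp S n x u) = branchComp T n x (Θ u) := by
  induction n generalizing x with
  | zero => rfl
  | succ n ih => rw [_root_.branchComp, h.branch (branchComp_mem S n _ hu), ih]; rfl

theorem exponent_pos (S T : ExpMap d ε) (x : ℕ → Fin d) : 0 < pot T x / pot S x :=
  div_pos_of_neg_of_neg (pot_neg T x) (pot_neg S x)

/-- Near an endpoint of the unit interval the conjugacy behaves like a power. -/
theorem IsConjugacy.exists_power_bound (hε : 0 < ε) {S T : ExpMap d ε} {Θ : ℝ → ℝ}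
    (h : IsConjugacy S T Θ) {i : Fin d} {q : ℝ} (hq : IsEnd i q) :
    ∃ C, ∀ t ∈ UI,
      |Θ t - q| ≤ C * |t - q| ^ (pot T (fun _ => i) / pot S (fun _ => i)) ∧
      |t - q| ^ (pot T (fun _ => i) / pot S (fun _ => i)) ≤ C * |Θ t - q| := by
  obtain ⟨K, hK⟩ := exists_distortionBound hε S
  obtain ⟨L, hL⟩ := exists_distortionBound hε T
  have hK0 : 0 < K := one_pos.trans_le hK.one_le
  have hL0 : 0 < L := one_pos.trans_le hL.one_le
  have hr := exponent_pos S T (fun _ => i)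
  set r := pot T (fun _ => i) / pot S (fun _ => i) with hrdef
  refine ⟨L * (K * K) ^ r + K ^ r * (L * L), fun t ht => ?_⟩
  rcases eq_or_ne t q with rfl | hne
  · rw [h.isEnd hq]; simp [hr.ne']
  rw [← hq.proj_const hε S] at hne
  obtain ⟨n, j, hj, s, hs, rfl⟩ := exists_exit hε S _ ht hne
  have hjs := S.branch_maps_to j hs
  have hΘjs := h.mem hjs
  set E := Real.exp (birk (pot S) n (fun _ => i)) with hE
  have hEF : Real.exp (birk (pot T) n (fun _ => i)) = E ^ r := by
    rw [hE, ← Real.exp_mul, birk_const, birk_const, hrdef, mul_assoc,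
      mul_div_cancel₀ _ (pot_neg S _).ne]
  have hE0 : 0 < E := Real.exp_pos _
  have hSq := branchComp_isEnd S hq n (fun _ => i) (fun _ _ => rfl)
  have hTq := branchComp_isEnd T hq n (fun _ => i) (fun _ _ => rfl)
  have s1 := hK.lower n (fun _ => i) _ hjs q hq.mem
  have s2 := hK.upper n (fun _ => i) _ hjs q hq.mem
  have t1 := hL.lower n (fun _ => i) _ hΘjs q hq.mem
  have t2 := hL.upper n (fun _ => i) _ hΘjs q hq.mem
  rw [hTq, ← h.branchComp n _ hjs, hEF] at t1 t2
  rw [hSq] at s1 s2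
  have g1 := hq.one_le_mul_abs_sub hK hj hs
  have g2 := hq.one_le_mul_abs_sub hL hj (h.mem hs)
  rw [← h.branch hs] at g2
  have b1 := abs_sub_le_one hjs hq.mem
  have b2 := abs_sub_le_one hΘjs hq.mem
  set X := |_root_.branchComp S n (fun _ => i) (S.branch j s) - q|
  set Y := |Θ (_root_.branchComp S n (fun _ => i) (S.branch j s)) - q|
  have hX : 0 ≤ X := abs_nonneg _
  have hY : 0 ≤ Y := abs_nonneg _
  have hEr : 0 < E ^ r := Real.rpow_pos_of_pos hE0 r
  have hKr : 0 ≤ K ^ r := Real.rpow_nonneg hK0.le r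
  have hEX : E ≤ K * K * X := by
    calc E ≤ E * (K * |S.branch j s - q|) := le_mul_of_one_le_right hE0.le g1
      _ = K * (E * |S.branch j s - q|) := by ring
      _ ≤ K * (K * X) := by gcongr
      _ = _ := by ring
  have hXE : X ≤ K * E := s2.trans (by gcongr; exact mul_le_of_le_one_right hE0.le b1)
  have hFY : E ^ r ≤ L * L * Y := by
    calc E ^ r ≤ E ^ r * (L * |Θ (S.branch j s) - q|) := le_mul_of_one_le_right hEr.le g2
      _ = L * (E ^ r * |Θ (S.branch j s) - q|) := by ring
      _ ≤ L * (L * Y) := by gcongr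
      _ = _ := by ring
  have hYF : Y ≤ L * E ^ r := t2.trans (by gcongr; exact mul_le_of_le_one_right hEr.le b2)
  have hEXr : E ^ r ≤ (K * K) ^ r * X ^ r := by
    rw [← Real.mul_rpow (by positivity) hX]
    exact Real.rpow_le_rpow hE0.le hEX hr.le
  have hXEr : X ^ r ≤ K ^ r * E ^ r := by
    rw [← Real.mul_rpow hK0.le hE0.le]
    exact Real.rpow_le_rpow hX hXE hr.le
  constructor
  · calc Y ≤ L * ((K * K) ^ r * X ^ r) := hYF.trans (by gcongr)
      _ ≤ _ := by
        rw [← mul_assoc]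
        gcongr
        exact le_add_of_nonneg_right (by positivity)
  · calc X ^ r ≤ K ^ r * (L * L * Y) := hXEr.trans (by gcongr)
      _ ≤ _ := by
        rw [← mul_assoc]
        gcongr
        exact le_add_of_nonneg_left (by positivity)

/-- The difference quotient of the conjugacy between `proj S y` and an endpoint of the first-level
interval containing it is controlled by a Birkhoff sum of `y`. -/
theorem IsConjugacy.exists_near_bound {S T : ExpMap d ε} {Θ : ℝ → ℝ}
    (h : IsConjugacy S T Θ) {K : ℝ} (hK : DistortionBound S K) (hL : DistortionBound T K)
    {y : ℕ → Fin d} (hy : ¬ EvConst y) {i : Fin d} {q : ℝ} (hq : IsEnd i q) :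
    ∃ k, |Θ (proj S y) - Θ (S.branch (y 0) q)| ≤
      K ^ 3 * Real.exp (birk (fun z => pot T z - pot S z) k y) *
        |proj S y - S.branch (y 0) q| := by
  obtain ⟨k, hk, hk'⟩ := exists_block_end (not_evConst_shift hy) i
  simp only [zero_add] at hk hk'
  refine ⟨k + 1, ?_⟩
  have hK0 : 0 < K := one_pos.trans_le hK.one_le
  have hp : S.branch (y 0) q = _root_.branchComp S (k + 1) y q := by
    rw [_root_.branchComp, branchComp_isEnd S hq k _ hk]
  have hu := proj_eq_branchComp S (k + 1) y
  have hm := proj_mem S (shift^[k + 1] y)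
  have hgap : 1 ≤ K * |proj S (shift^[k + 1] y) - q| := by
    rw [proj_eq_branch]
    refine hq.one_le_mul_abs_sub hK ?_ (proj_mem S _)
    rwa [shift_iterate_apply, zero_add]
  have s1 := hK.lower (k + 1) y _ hm q hq.mem
  have t2 := hL.upper (k + 1) y _ (h.mem hm) q hq.mem
  have hb : |Θ (proj S (shift^[k + 1] y)) - q| ≤ 1 := abs_sub_le_one (h.mem hm) hq.mem
  rw [birk_sub, Real.exp_sub, hp, hu, h.branchComp _ _ hm, h.branchComp _ _ hq.mem, h.isEnd hq]
  set E := Real.exp (birk (pot S) (k + 1) y)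
  set F := Real.exp (birk (pot T) (k + 1) y)
  set X := |_root_.branchComp S (k + 1) y (proj S (shift^[k + 1] y)) -
    _root_.branchComp S (k + 1) y q|
  have hE : 0 < E := Real.exp_pos _
  have hF : 0 < F := Real.exp_pos _
  have hEX : E ≤ K * K * X := by
    calc E ≤ E * (K * |proj S (shift^[k + 1] y) - q|) := le_mul_of_one_le_right hE.le hgap
      _ = K * (E * |proj S (shift^[k + 1] y) - q|) := by ring
      _ ≤ K * (K * X) := by gcongr
      _ = _ := by ring
  calc _ ≤ K * F := t2.trans (by gcongr; exact mul_le_of_le_one_right hF.le hb)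
    _ = K * (F / E) * E := by field_simp
    _ ≤ K * (F / E) * (K * K * X) := by gcongr
    _ = _ := by ring

theorem rpow_le_mul_rpow_sub {r A B X : ℝ} (hr : r < 1) (hX : 0 < X) (hXB : X ≤ B)
    (h : X ^ r ≤ A) : B ^ r ≤ B * (A / X) := by
  have hB : 0 < B := hX.trans_le hXB
  calc B ^ r = B * B ^ (r - 1) := by rw [Real.rpow_sub_one hB.ne']; field_simp
    _ ≤ B * X ^ (r - 1) :=
      mul_le_mul_of_nonneg_left (Real.rpow_le_rpow_of_nonpos hX hXB (sub_nonpos.2 hr.le)) hB.le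
    _ = B * (X ^ r / X) := by rw [Real.rpow_sub_one hX.ne']
    _ ≤ _ := by gcongr

/-- The difference quotient of the conjugacy at `proj S y`, with respect to a point in another
first-level interval, is controlled by the Birkhoff sums of `y`. -/
theorem IsConjugacy.exists_local_bound (hd : 2 ≤ d) (hε : 0 < ε) {S T : ExpMap d ε} {Θ : ℝ → ℝ}
    (h : IsConjugacy S T Θ)
    (hr : ∀ (i i' : Fin d) (q : ℝ), IsEnd i q → IsEnd i' (1 - q) →
      1 ≤ pot T (fun _ => i') / pot S (fun _ => i') ∨
      (pot T (fun _ => i) / pot S (fun _ => i) = pot T (fun _ => i') / pot S (fun _ => i') ∧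
        pot T (fun _ => i') / pot S (fun _ => i') < 1)) :
    ∃ C, ∀ y : ℕ → Fin d, ¬ EvConst y → ∀ j ≠ y 0, ∀ t ∈ UI, ∃ k,
      |Θ (proj S y) - Θ (S.branch j t)| ≤
        C * (Real.exp (birk (fun z => pot T z - pot S z) k y) *
          |proj S y - S.branch j t|) := by
  obtain ⟨K₁, hK₁⟩ := exists_distortionBound hε S
  obtain ⟨K₂, hK₂⟩ := exists_distortionBound hε T
  obtain ⟨K, hK, hL⟩ : ∃ K, DistortionBound S K ∧ DistortionBound T K :=
    ⟨max K₁ K₂, hK₁.mono (le_max_left _ _), hK₂.mono (le_max_right _ _)⟩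
  have hK0 : 0 < K := one_pos.trans_le hK.one_le
  set ρ : Fin d → ℝ := fun i => pot T (fun _ => i) / pot S (fun _ => i) with hρ
  have hρpos : ∀ i, 0 < ρ i := fun i => exponent_pos S T _
  obtain ⟨C, hC0, hKC, hC⟩ : ∃ C, 0 ≤ C ∧ (∀ i, K ^ ρ i ≤ C) ∧ ∀ i q, IsEnd i q → ∀ t ∈ UI,
      |Θ t - q| ≤ C * |t - q| ^ ρ i ∧ |t - q| ^ ρ i ≤ C * |Θ t - q| := by
    have hex : ∀ i : Fin d, ∃ C, ∀ q, IsEnd i q → ∀ t ∈ UI,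
        |Θ t - q| ≤ C * |t - q| ^ ρ i ∧ |t - q| ^ ρ i ≤ C * |Θ t - q| := by
      intro i
      by_cases hi : ∃ q, IsEnd i q
      · obtain ⟨q, hq⟩ := hi
        obtain ⟨C, hC⟩ := h.exists_power_bound hε hq
        refine ⟨C, fun q' hq' => ?_⟩
        obtain rfl : q = q' := by
          rcases hq with ⟨h1, rfl⟩ | ⟨h1, rfl⟩ <;> rcases hq' with ⟨h2, rfl⟩ | ⟨h2, rfl⟩ <;>
            first | rfl | omega
        exact hC
      · exact ⟨0, fun q hq => absurd ⟨q, hq⟩ hi⟩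
    choose C hC using hex
    obtain ⟨M, hM⟩ := Finite.exists_le C
    obtain ⟨R, hR⟩ := Finite.exists_le fun i => K ^ ρ i
    refine ⟨max (max M R) 0, le_max_right _ _,
      fun i => (hR i).trans ((le_max_right _ _).trans (le_max_left _ _)), fun i q hq t ht => ?_⟩
    have hle : C i ≤ max (max M R) 0 := (hM i).trans ((le_max_left _ _).trans (le_max_left _ _))
    obtain ⟨h1, h2⟩ := hC i q hq t ht
    exact ⟨h1.trans (by gcongr), h2.trans (by gcongr)⟩
  refine ⟨K ^ 3 + C * C + C * C * (C * K * K ^ 3), fun y hy j hj t ht => ?_⟩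
  have hproj := proj_eq_branch S y
  have hs := proj_mem S (shift y)
  obtain ⟨i, q, i', hq, hq', b, hbp, hsum, hfar⟩ := exists_separating_end hd S hj hs ht
  rw [← hproj] at hsum
  obtain ⟨k, hk⟩ := h.exists_near_bound hK hL hy hq
  have hv := S.branch_maps_to j ht
  have hp := S.branch_maps_to (y 0) hq.mem
  have hY' : |Θ (S.branch (y 0) q) - Θ (S.branch j t)| ≤
      C * C * |S.branch (y 0) q - S.branch j t| ^ ρ i' := by
    have hbase : ∀ w, 0 ≤ w → w ≤ K * |S.branch (y 0) q - S.branch j t| →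
        C * w ^ ρ i' ≤ C * C * |S.branch (y 0) q - S.branch j t| ^ ρ i' := by
      intro w hw0 hw
      rw [mul_assoc]
      refine mul_le_mul_of_nonneg_left ?_ hC0
      refine (Real.rpow_le_rpow hw0 hw (hρpos i').le).trans ?_
      rw [Real.mul_rpow hK0.le (abs_nonneg _)]
      exact mul_le_mul_of_nonneg_right (hKC i') (Real.rpow_nonneg (abs_nonneg _) _)
    rcases hfar with rfl | hfar
    · refine le_trans ?_ (hbase |t - (1 - q)| (abs_nonneg _) ?_)
      · rw [← hbp, h.branch hq'.mem, h.branch ht, h.isEnd hq']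
        refine (abs_branch_sub_le T _ hq'.mem (h.mem ht)).trans ?_
        rw [abs_sub_comm]
        exact (hC i' _ hq' t ht).1
      · rw [abs_sub_comm, ← hbp]
        exact hK.branch_lower j _ hq'.mem t ht
    · refine le_trans (abs_sub_le_one (h.mem hp) (h.mem hv)) (le_trans ?_ (hbase 1 zero_le_one ?_))
      · have h1 := (hC i' _ hq' q hq.mem).1
        rw [h.isEnd hq] at h1
        have h2 : |q - (1 - q)| = 1 := by
          rcases hq with ⟨-, rfl⟩ | ⟨-, rfl⟩ <;> norm_num
        rwa [h2] at h1
      · have h1 := hK.branch_lower b q hq.mem _ hq'.mem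
        have h2 : |q - (1 - q)| = 1 := by
          rcases hq with ⟨-, rfl⟩ | ⟨-, rfl⟩ <;> norm_num
        rw [h2] at h1
        exact h1.trans (mul_le_mul_of_nonneg_left hfar hK0.le)
  have htri : |Θ (proj S y) - Θ (S.branch j t)| ≤ |Θ (proj S y) - Θ (S.branch (y 0) q)| +
      |Θ (S.branch (y 0) q) - Θ (S.branch j t)| := abs_sub_le _ _ _
  have hYle : |S.branch (y 0) q - S.branch j t| ≤ 1 := abs_sub_le_one hp hv
  have hXpos : 0 < |proj S y - S.branch (y 0) q| := by
    rw [abs_pos, sub_ne_zero, hproj]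
    exact fun he => proj_ne_isEnd hε S (not_evConst_shift hy) hq
      ((S.branch_mono (y 0)).injOn hs hq.mem he)
  have hXr : |proj S y - S.branch (y 0) q| ^ ρ i ≤
      C * (K * |Θ (proj S y) - Θ (S.branch (y 0) q)|) := by
    have h1 : |proj S y - S.branch (y 0) q| ≤ |proj S (shift y) - q| := by
      rw [hproj]; exact abs_branch_sub_le S _ hs hq.mem
    refine (Real.rpow_le_rpow hXpos.le h1 (hρpos i).le).trans
      ((hC i q hq _ hs).2.trans (mul_le_mul_of_nonneg_left ?_ hC0))
    rw [hproj, h.branch hs, h.branch hq.mem, h.isEnd hq]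
    exact hL.branch_lower _ _ (h.mem hs) q hq.mem
  rw [hsum]
  set X := |proj S y - S.branch (y 0) q|
  set Y := |S.branch (y 0) q - S.branch j t|
  set X' := |Θ (proj S y) - Θ (S.branch (y 0) q)|
  have hY0 : 0 ≤ Y := abs_nonneg _
  set e := Real.exp (birk (fun z => pot T z - pot S z) k y) with he
  have he0 : 0 < e := Real.exp_pos _
  have hZ : 0 ≤ C * C * (C * K * K ^ 3) := by positivity
  rcases hr i i' q hq hq' with h1 | ⟨hrr, hlt⟩
  · have hYY : Y ^ ρ i' ≤ Y := by
      rcases hY0.eq_or_lt with h0 | h0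
      · rw [← h0, Real.zero_rpow (hρpos i').ne']
      · simpa using Real.rpow_le_rpow_of_exponent_ge h0 hYle h1
    have hfin : ∀ f, e ≤ f → 1 ≤ f → |Θ (proj S y) - Θ (S.branch j t)| ≤
        (K ^ 3 + C * C + C * C * (C * K * K ^ 3)) * (f * (X + Y)) := by
      intro f hef hf
      have hf0 : 0 ≤ f := zero_le_one.trans hf
      have hYf : Y ≤ f * Y := le_mul_of_one_le_left hY0 hf
      calc _ ≤ K ^ 3 * e * X + C * C * Y ^ ρ i' := htri.trans (add_le_add hk hY')
        _ ≤ K ^ 3 * f * X + C * C * (f * Y) := by gcongr; exact hYY.trans hYf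
        _ ≤ _ := by
          have a1 : 0 ≤ K ^ 3 * (f * Y) := by positivity
          have a2 : 0 ≤ C * C * (f * X) := by positivity
          have a3 : 0 ≤ C * C * (C * K * K ^ 3) * (f * (X + Y)) := by positivity
          linarith
    rcases le_total 1 e with h1e | h1e
    · exact ⟨k, hfin e le_rfl h1e⟩
    · exact ⟨0, by simpa [birk] using hfin 1 h1e le_rfl⟩
  · refine ⟨k, ?_⟩
    change ρ i = ρ i' at hrr
    rw [hrr] at hXr
    have h2 := rpow_le_mul_rpow_sub (B := X + Y) hlt hXpos (by linarith) hXr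
    have h3 : Y ^ ρ i' ≤ (X + Y) ^ ρ i' := Real.rpow_le_rpow hY0 (by linarith) (hρpos i').le
    have h4 : X' / X ≤ K ^ 3 * e := (div_le_iff₀ hXpos).2 hk
    have h5 : Y ^ ρ i' ≤ C * K * K ^ 3 * (e * (X + Y)) := by
      calc _ ≤ (X + Y) * (C * (K * X') / X) := h3.trans h2
        _ = (X + Y) * (C * K) * (X' / X) := by ring
        _ ≤ (X + Y) * (C * K) * (K ^ 3 * e) := by gcongr
        _ = _ := by ring
    calc _ ≤ K ^ 3 * e * X + C * C * Y ^ ρ i' := htri.trans (add_le_add hk hY')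
      _ ≤ K ^ 3 * e * X + C * C * (C * K * K ^ 3 * (e * (X + Y))) := by gcongr
      _ ≤ _ := by
        have a1 : 0 ≤ K ^ 3 * (e * Y) := by positivity
        have a2 : 0 ≤ C * C * (e * (X + Y)) := by positivity
        linarith

/-- Points close to `proj S x` share an arbitrarily long initial part of its coding. -/
theorem eventually_exit_ge (hε : 0 < ε) (S : ExpMap d ε) {x : ℕ → Fin d} (hx : ¬ EvConst x)
    (N : ℕ) :
    ∀ᶠ η in 𝓝[UI \ {proj S x}] (proj S x),
      ∃ n ≥ N, ∃ j ≠ x n, ∃ t ∈ UI, η = branchComp S n x (S.branch j t) := by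
  have hy := not_evConst_shift_iterate hx N
  set z := proj S (shift^[N] x) with hz
  have hzm : z ∈ UI := proj_mem S _
  have h0 : (0 : ℝ) ∈ UI := by simp
  have h1 : (1 : ℝ) ∈ UI := by simp
  have hd : 0 < d := (Nat.zero_le _).trans_lt (x 0).2
  have hz0 : 0 < z := hzm.1.lt_of_ne
    (proj_ne_isEnd hε S hy (i := ⟨0, hd⟩) (Or.inl ⟨rfl, rfl⟩)).symm
  have hz1 : z < 1 := hzm.2.lt_of_ne
    (proj_ne_isEnd hε S hy (i := ⟨d - 1, by omega⟩) (Or.inr ⟨rfl, rfl⟩))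
  have hmono := branchComp_strictMonoOn S N x
  have hnhds : Set.Icc (branchComp S N x 0) (branchComp S N x 1) ∈ 𝓝 (proj S x) := by
    rw [proj_eq_branchComp S N x]
    exact Icc_mem_nhds (hmono h0 hzm hz0) (hmono hzm h1 hz1)
  filter_upwards [self_mem_nhdsWithin, nhdsWithin_le_nhds hnhds] with η hη hηI
  obtain ⟨v, hv, hvη⟩ := intermediate_value_Icc zero_le_one (continuousOn_branchComp S N x) hηI
  have hvz : v ≠ z := by
    rintro rfl
    exact hη.2 (by rw [Set.mem_singleton_iff, ← hvη, proj_eq_branchComp S N x])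
  obtain ⟨n, j, hj, t, ht, rfl⟩ := exists_exit hε S _ hv hvz
  rw [shift_iterate_apply] at hj
  refine ⟨n + N, by omega, j, hj, t, ht, ?_⟩
  rw [← hvη, add_comm, branchComp_add]

end Branches

/-- Lemma `Alternative`.  If neither `ψ(1̄)/φ(1̄) < min{ψ(d̄)/φ(d̄),1}`
nor `ψ(d̄)/φ(d̄) < min{ψ(1̄)/φ(1̄),1}` holds, then for every `x ∈ Σ` not eventually
constant with `lim_n S_nχ(x) = -∞`, the generalised derivative of `Θ` exists at
`ξ := π_S(x)`; in fact `lim_{η→ξ} D_Θ(ξ,η)` exists and equals a finite value `L ≥ 0`. -/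
theorem statement_7 {d : ℕ} {ε : ℝ} (hd : 2 ≤ d) (hε : 0 < ε)
    (S T : ExpMap d ε) (Θ : ℝ → ℝ) (hΘ : IsConjugacy S T Θ)
    (hcase1 : ¬ (pot T (fun _ => (⟨0, by omega⟩ : Fin d)) /
        pot S (fun _ => (⟨0, by omega⟩ : Fin d)) <
      min (pot T (fun _ => (⟨d - 1, by omega⟩ : Fin d)) /
        pot S (fun _ => (⟨d - 1, by omega⟩ : Fin d))) 1))
    (hcase2 : ¬ (pot T (fun _ => (⟨d - 1, by omega⟩ : Fin d)) /
        pot S (fun _ => (⟨d - 1, by omega⟩ : Fin d)) <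
      min (pot T (fun _ => (⟨0, by omega⟩ : Fin d)) /
        pot S (fun _ => (⟨0, by omega⟩ : Fin d))) 1))
    (x : ℕ → Fin d) (hx : ¬ EvConst x)
    (hsum : Filter.Tendsto (fun n => birk (fun z => pot T z - pot S z) n x)
      Filter.atTop Filter.atBot) :
    GenDeriv Θ (proj S x) ∧
      ∃ L : ℝ, 0 ≤ L ∧ Filter.Tendsto (fun η => DQ Θ (proj S x) η)
        (nhdsWithin (proj S x) (UI \ {proj S x})) (nhds L) := by
  have hr : ∀ (i i' : Fin d) (q : ℝ), IsEnd i q → IsEnd i' (1 - q) →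
      1 ≤ pot T (fun _ => i') / pot S (fun _ => i') ∨
      (pot T (fun _ => i) / pot S (fun _ => i) = pot T (fun _ => i') / pot S (fun _ => i') ∧
        pot T (fun _ => i') / pot S (fun _ => i') < 1) := by
    intro i i' q hq hq'
    rw [lt_min_iff] at hcase1 hcase2
    have hend : (i = ⟨0, by omega⟩ ∧ i' = ⟨d - 1, by omega⟩) ∨
        (i = ⟨d - 1, by omega⟩ ∧ i' = ⟨0, by omega⟩) := by
      rcases hq with ⟨h1, rfl⟩ | ⟨h1, rfl⟩ <;> rcases hq' with ⟨h2, h3⟩ | ⟨h2, h3⟩ <;>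
        norm_num at h3
      · exact Or.inl ⟨Fin.ext h1, Fin.ext h2⟩
      · exact Or.inr ⟨Fin.ext h1, Fin.ext h2⟩
    rcases hend with ⟨rfl, rfl⟩ | ⟨rfl, rfl⟩ <;> grind
  obtain ⟨C, hC⟩ := hΘ.exists_local_bound hd hε hr
  obtain ⟨K, hK⟩ := exists_distortionBound hε S
  obtain ⟨L, hL⟩ := exists_distortionBound hε T
  have hK0 : 0 < K := one_pos.trans_le hK.one_le
  have hL0 : 0 < L := one_pos.trans_le hL.one_le
  have key : Tendsto (fun η => DQ Θ (proj S x) η) (𝓝[UI \ {proj S x}] (proj S x)) (𝓝 0) := by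
    rw [Metric.tendsto_nhds]
    intro δ hδ
    have hlim : Tendsto (fun n => L * K * |C| *
        Real.exp (birk (fun z => pot T z - pot S z) n x)) atTop (𝓝 0) := by
      simpa using (Real.tendsto_exp_atBot.comp hsum).const_mul (L * K * |C|)
    obtain ⟨N, hN⟩ := eventually_atTop.1 (hlim.eventually (gt_mem_nhds hδ))
    filter_upwards [eventually_exit_ge hε S hx N, self_mem_nhdsWithin] with η hη hηmem
    obtain ⟨n, hn, j, hj, t, ht, rfl⟩ := hη
    have hy := not_evConst_shift_iterate hx n
    obtain ⟨k, hk⟩ := hC _ hy j (by rwa [shift_iterate_apply, zero_add]) t ht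
    have hm := proj_mem S (shift^[n] x)
    have hjt := S.branch_maps_to j ht
    refine lt_of_le_of_lt ?_ (hN (n + k) (by omega))
    have hne := abs_pos.2 (sub_ne_zero.2 (Ne.symm hηmem.2))
    rw [dist_zero_right, Real.norm_eq_abs, DQ, abs_div, div_le_iff₀ hne]
    have t2 := hL.upper n x _ (hΘ.mem hm) _ (hΘ.mem hjt)
    have s1 := hK.lower n x _ hm _ hjt
    rw [← hΘ.branchComp _ _ hm, ← hΘ.branchComp _ _ hjt, ← proj_eq_branchComp] at t2
    rw [← proj_eq_branchComp] at s1
    have hE : Real.exp (birk (pot T) n x) =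
        Real.exp (birk (fun z => pot T z - pot S z) n x) * Real.exp (birk (pot S) n x) := by
      rw [← Real.exp_add, birk_sub, sub_add_cancel]
    rw [birk_add, Real.exp_add]
    rw [hE] at t2
    set e := Real.exp (birk (fun z => pot T z - pot S z) n x)
    set e' := Real.exp (birk (fun z => pot T z - pot S z) k (shift^[n] x))
    set E := Real.exp (birk (pot S) n x)
    set D := |proj S (shift^[n] x) - S.branch j t|
    set D' := |proj S x - branchComp S n x (S.branch j t)|
    calc _ ≤ L * (e * E * (|C| * (e' * D))) := t2.trans (by
          gcongr
          refine hk.trans ?_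
          gcongr
          exact le_abs_self C)
      _ = L * |C| * (e * e') * (E * D) := by ring
      _ ≤ L * |C| * (e * e') * (K * D') := by gcongr
      _ = _ := by ring
  exact ⟨Or.inl ⟨0, key⟩, 0, le_rfl, key⟩
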